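/- Let ℓ ≥ 1 and d ≥ 1 be integers, set m = ℓd, and let E be a real inner product space of dimension m. Let A be a self-adjoint endomorphism of E whose eigenvalues, with multiplicity, are: 0 with multiplicity 1, 2 with multiplicity d−1, and 1 with multiplicity (ℓ−1)d. Then δ_k(A) ≥ m + d − 2 − 4k for every integer k with 0 ≤ k ≤ d−1, and δ_k(A) ≥ m − d − 2k for every integer k with d−1 ≤ k ≤ m. -/

import Mathlib

/-- The trace of an endomorphism `A` restricted to a subspace `L`,
computed as `∑ᵢ ⟨A uᵢ, uᵢ⟩` for an orthonormal basis `(uᵢ)` of `L`. -/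
noncomputable def trRestrict {E : Type*} [NormedAddCommGroup E] [InnerProductSpace ℝ E]
    [FiniteDimensional ℝ E] (A : E →ₗ[ℝ] E) (L : Submodule ℝ E) : ℝ :=
  ∑ i, (inner ℝ (A ((stdOrthonormalBasis ℝ L i : L) : E))
    ((stdOrthonormalBasis ℝ L i : L) : E) : ℝ)

/-- `δ_k(A)`: the infimum over all subspaces `L` of codimension `k`
of `tr(A|_L) − tr(A|_{L^⊥})`. -/
noncomputable def deltaK {E : Type*} [NormedAddCommGroup E] [InnerProductSpace ℝ E]
    [FiniteDimensional ℝ E] (A : E →ₗ[ℝ] E) (k : ℕ) : ℝ :=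
  sInf ((fun L : Submodule ℝ E => trRestrict A L - trRestrict A Lᗮ) ''
    {L : Submodule ℝ E | Module.finrank ℝ L = Module.finrank ℝ E - k})

theorem trR_sum_w {E : Type*} [NormedAddCommGroup E] [InnerProductSpace ℝ E]
    [FiniteDimensional ℝ E] {m : ℕ} (b : OrthonormalBasis (Fin m) ℝ E) (L : Submodule ℝ E)
    (i : Fin m) : ∑ j, (inner ℝ (b i) ((stdOrthonormalBasis ℝ L j : L) : E) : ℝ) ^ 2
      = ‖L.orthogonalProjectionOnto (b i)‖ ^ 2 := by
  rw [← (stdOrthonormalBasis ℝ L).sum_sq_norm_inner_right (L.orthogonalProjectionOnto (b i))]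
  refine Finset.sum_congr rfl fun j _ => ?_
  rw [Submodule.inner_orthogonalProjectionOnto_eq_of_mem_left, real_inner_comm, Real.norm_eq_abs,
    sq_abs]

theorem trR_eq {E : Type*} [NormedAddCommGroup E] [InnerProductSpace ℝ E]
    [FiniteDimensional ℝ E] {m : ℕ} (A : E →ₗ[ℝ] E)
    (hAsym : ∀ u v : E, (inner ℝ (A u) v : ℝ) = inner ℝ u (A v))
    (μ : Fin m → ℝ) (b : OrthonormalBasis (Fin m) ℝ E)
    (hb : ∀ i, A (b i) = μ i • b i) (L : Submodule ℝ E) :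
    trRestrict A L = ∑ i, μ i * ‖L.orthogonalProjectionOnto (b i)‖ ^ 2 := by
  unfold trRestrict
  simp_rw [← trR_sum_w b L, Finset.mul_sum]
  rw [Finset.sum_comm]
  refine Finset.sum_congr rfl fun j _ => ?_
  rw [← b.sum_inner_mul_inner]
  refine Finset.sum_congr rfl fun i _ => ?_
  rw [hAsym, hb, inner_smul_right, real_inner_comm]
  ring

theorem trR_dim {E : Type*} [NormedAddCommGroup E] [InnerProductSpace ℝ E]
    [FiniteDimensional ℝ E] {m : ℕ} (b : OrthonormalBasis (Fin m) ℝ E) (L : Submodule ℝ E) :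
    ∑ i, ‖L.orthogonalProjectionOnto (b i)‖ ^ 2 = (Module.finrank ℝ L : ℝ) := by
  simp_rw [← trR_sum_w b L]
  rw [Finset.sum_comm]
  have : ∀ j, ∑ i, (inner ℝ (b i) ((stdOrthonormalBasis ℝ L j : L) : E) : ℝ) ^ 2 = 1 := by
    intro j
    have h := b.sum_sq_norm_inner_right ((stdOrthonormalBasis ℝ L j : L) : E)
    simp only [Real.norm_eq_abs, sq_abs] at h
    rw [h]
    have := (stdOrthonormalBasis ℝ L).orthonormal.1 j
    rw [Submodule.coe_norm] at this
    rw [this]; norm_num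
  simp [this]

theorem exists_sub_finrank {E : Type*} [NormedAddCommGroup E] [InnerProductSpace ℝ E]
    [FiniteDimensional ℝ E] (n : ℕ) (hn : n ≤ Module.finrank ℝ E) :
    ∃ L : Submodule ℝ E, Module.finrank ℝ L = n := by
  have hli := (Module.finBasis ℝ E).linearIndependent.comp (Fin.castLE hn)
    (Fin.castLE_injective hn)
  exact ⟨_, by simpa using finrank_span_eq_card hli⟩

/-- Let `ℓ, d ≥ 1`, `m = ℓd`, and let `A` be a self-adjoint endomorphism of an
`m`-dimensional real inner product space whose eigenvalues (with multiplicity) are `0`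
with multiplicity `1`, `2` with multiplicity `d−1`, and `1` with multiplicity `(ℓ−1)d`.
Then `δ_k(A) ≥ m + d − 2 − 4k` for `0 ≤ k ≤ d−1` and `δ_k(A) ≥ m − d − 2k` for
`d−1 ≤ k ≤ m`. -/
theorem deltaK_lower_bound_hyperbolic
    {E : Type*} [NormedAddCommGroup E] [InnerProductSpace ℝ E] [FiniteDimensional ℝ E]
    (ℓ d m : ℕ) (hℓ : 1 ≤ ℓ) (hd : 1 ≤ d) (hm : m = ℓ * d)
    (hE : Module.finrank ℝ E = m)
    (A : E →ₗ[ℝ] E) (hAsym : ∀ u v : E, (inner ℝ (A u) v : ℝ) = inner ℝ u (A v))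
    (μ : Fin m → ℝ) (b : OrthonormalBasis (Fin m) ℝ E)
    (hb : ∀ i, A (b i) = μ i • b i)
    (hc0 : (Finset.univ.filter (fun i : Fin m => μ i = 0)).card = 1)
    (hc2 : (Finset.univ.filter (fun i : Fin m => μ i = 2)).card = d - 1)
    (hc1 : (Finset.univ.filter (fun i : Fin m => μ i = 1)).card = (ℓ - 1) * d) :
    (∀ k : ℕ, k ≤ d - 1 → ((m : ℝ) + d - 2 - 4 * k) ≤ deltaK A k) ∧
      (∀ k : ℕ, d - 1 ≤ k → k ≤ m → ((m : ℝ) - d - 2 * k) ≤ deltaK A k) := by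
  have hcard : ℓ * d = 1 + (d - 1) + (ℓ - 1) * d := by
    obtain ⟨l, rfl⟩ := Nat.exists_eq_add_of_le hℓ
    rw [Nat.add_sub_cancel_left, Nat.add_mul]
    omega
  have hdm : d ≤ m := by rw [hm, hcard]; omega
  have hμ : ∀ i, μ i = 0 ∨ μ i = 2 ∨ μ i = 1 := by
    have hu : (Finset.univ.filter (fun i : Fin m => μ i = 0 ∨ μ i = 2 ∨ μ i = 1))
        = Finset.univ := by
      apply Finset.eq_univ_of_card
      rw [Finset.filter_or, Finset.card_union_of_disjoint, Finset.filter_or,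
        Finset.card_union_of_disjoint, hc0, hc1, hc2, Fintype.card_fin, hm, hcard]
      · ring
      · rw [Finset.disjoint_filter]; intro i _ h1 h2; linarith
      · rw [Finset.disjoint_filter]
        rintro i _ h1 (h2 | h2) <;> linarith
    intro i
    have := Finset.mem_univ i
    rw [← hu] at this
    simpa using this
  have hs1 : ∑ i, (if μ i = 1 then (1 : ℝ) else 0) = ((ℓ : ℝ) - 1) * d := by
    rw [Finset.sum_boole, hc1]; push_cast [hℓ]; ring
  have hs2 : ∑ i, (if μ i = 2 then (1 : ℝ) else 0) = (d : ℝ) - 1 := by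
    rw [Finset.sum_boole, hc2]; push_cast [hd]; ring
  have hsum : ∑ i, μ i = (m : ℝ) + d - 2 := by
    have : ∀ i, μ i = (if μ i = 1 then (1 : ℝ) else 0) + 2 * (if μ i = 2 then (1 : ℝ) else 0) := by
      intro i
      rcases hμ i with h | h | h <;> rw [h] <;> norm_num
    rw [Finset.sum_congr rfl fun i _ => this i, Finset.sum_add_distrib, ← Finset.mul_sum, hs1, hs2,
      hm]
    push_cast; ring
  have key : ∀ k : ℕ, k ≤ m → ∀ c : ℝ,
      (∀ w : Fin m → ℝ, (∀ i, 0 ≤ w i) → (∀ i, w i ≤ 1) → ∑ i, w i = k →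
        c ≤ (m : ℝ) + d - 2 - 2 * ∑ i, μ i * w i) → c ≤ deltaK A k := by
    intro k hk c h
    unfold deltaK
    apply le_csInf
    · obtain ⟨L, hL⟩ := exists_sub_finrank (E := E) (Module.finrank ℝ E - k) (Nat.sub_le _ _)
      exact ⟨_, L, hL, rfl⟩
    · rintro _ ⟨L, hL, rfl⟩
      have hL' : Module.finrank ℝ L = Module.finrank ℝ E - k := hL
      have hp : ∀ i, ‖L.orthogonalProjectionOnto (b i)‖ ^ 2 + ‖Lᗮ.orthogonalProjectionOnto (b i)‖ ^ 2
          = 1 := by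
        intro i
        have := L.norm_sq_eq_add_norm_sq_projection (b i)
        rw [b.orthonormal.1 i] at this
        linarith
      have hfin := L.finrank_add_finrank_orthogonal
      have hw := h (fun i => ‖Lᗮ.orthogonalProjectionOnto (b i)‖ ^ 2) (fun i => by positivity)
        (fun i => by have := hp i; have := sq_nonneg ‖L.orthogonalProjectionOnto (b i)‖; linarith)
        (by rw [trR_dim]; congr 1; omega)
      dsimp only
      rw [trR_eq A hAsym μ b hb, trR_eq A hAsym μ b hb]
      have e : ∑ i, μ i * ‖L.orthogonalProjectionOnto (b i)‖ ^ 2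
          = ∑ i, μ i - ∑ i, μ i * ‖Lᗮ.orthogonalProjectionOnto (b i)‖ ^ 2 := by
        rw [← Finset.sum_sub_distrib]
        refine Finset.sum_congr rfl fun i _ => ?_
        rw [eq_sub_of_add_eq (hp i)]; ring
      rw [e, hsum]
      linarith
  constructor
  · intro k hk
    refine key k (by omega) _ fun w h0 h1 hw => ?_
    have : ∑ i, μ i * w i ≤ ∑ i, 2 * w i := by
      refine Finset.sum_le_sum fun i _ => ?_
      have := h0 i
      rcases hμ i with h | h | h <;> rw [h] <;> linarith
    rw [← Finset.mul_sum, hw] at this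
    linarith
  · intro k hk hkm
    refine key k hkm _ fun w h0 h1 hw => ?_
    have : ∑ i, μ i * w i ≤ ∑ i, (w i + (if μ i = 2 then (1 : ℝ) else 0)) := by
      refine Finset.sum_le_sum fun i _ => ?_
      have := h0 i
      have := h1 i
      rcases hμ i with h | h | h <;> rw [h] <;> norm_num <;> linarith
    rw [Finset.sum_add_distrib, hs2, hw] at this
    linarith
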